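/- arXiv:1712.05445 — 3 statements merged into one kernel-verified Lean document; each statement's English description precedes it below -/
import Mathlib

section
/- Let θ, σ, T > 0, let α, ρ ∈ ℝ, and let (ν_k)_{k≥1}, (q_k)_{k≥1} be sequences of positive reals with ν_k → ∞ and q_k → 0. Assume (i) there exists M ∈ ℝ with ν_n^{α−1} q_n^{2ρ+2} ≤ M for all n ≥ 1, and (ii) Σ_{k≥1} ν_k^{α} q_k^{2ρ+2} = ∞. Let (u_k)_{k≥1} be independent stochastic processes on a common probability space, where u_k is a (θ, σ, ν_k, q_k)-Ornstein–Uhlenbeck process with zero initial condition and continuous sample paths. Define for N ≥ 1 the estimator θ̂_N := −[Σ_{k=1}^{N} ν_k^{α} q_k^{2ρ} (u_k(T)² − σ² q_k² T)] / [2 Σ_{k=1}^{N} ν_k^{1+α} q_k^{2ρ} ∫_0^T u_k(t)² dt]. Then θ̂_N → θ almost surely as N → ∞. -/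
open MeasureTheory ProbabilityTheory Real Filter

noncomputable section

/-- A finite random vector `X` is centered Gaussian with covariance matrix `C`:
every linear combination of its coordinates is a centered real Gaussian with the
corresponding variance. -/
def IsCenteredGaussianVec {Ω : Type*} [MeasurableSpace Ω] (P : Measure Ω)
    {n : ℕ} (X : Fin n → Ω → ℝ) (C : Fin n → Fin n → ℝ) : Prop :=
  ∀ a : Fin n → ℝ,
    Measure.map (fun ω => ∑ i, a i * X i ω) P
      = gaussianReal 0 (∑ i, ∑ j, a i * a j * C i j).toNNReal

/-- Covariance function of the `(θ, σ, ν, q)`-Ornstein–Uhlenbeck process with zero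
initial condition. -/
def ouCov (θ σ ν q s t : ℝ) : ℝ :=
  (σ ^ 2 * q ^ 2 / (2 * θ * ν)) *
    (Real.exp (-(θ * ν * |t - s|)) - Real.exp (-(θ * ν * (t + s))))

/-- The family `u k`, `k ∈ ℕ`, consists of independent `(θ, σ, ν k, q k)`-Ornstein–Uhlenbeck
processes with zero initial condition on `[0, T]`: any finite collection of values of the
processes is jointly centered Gaussian, with OU covariances within each process and zero
cross-covariances between distinct processes. -/
def IsIndepOUFamily {Ω : Type*} [MeasurableSpace Ω] (P : Measure Ω)
    (u : ℕ → ℝ → Ω → ℝ) (θ σ : ℝ) (ν q : ℕ → ℝ) (T : ℝ) : Prop :=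
  ∀ (n : ℕ) (k : Fin n → ℕ) (t : Fin n → ℝ), (∀ i, t i ∈ Set.Icc (0 : ℝ) T) →
    IsCenteredGaussianVec P (fun i ω => u (k i) (t i) ω)
      (fun i j => if k i = k j then ouCov θ σ (ν (k i)) (q (k i)) (t i) (t j) else 0)


open scoped NNReal ENNReal

lemma integral_pow_four_gaussianReal (v : ℝ≥0) :
    ∫ x, x ^ 4 ∂(gaussianReal 0 v) = 3 * (v : ℝ) ^ 2 := by
  have h := iteratedDeriv_mgf_zero (X := id) (μ := gaussianReal 0 v)
    (by simp [integrableExpSet_id_gaussianReal]) 4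
  have hint : (gaussianReal 0 v)[(id : ℝ → ℝ) ^ 4] = ∫ x, x ^ 4 ∂(gaussianReal 0 v) := rfl
  have hmgf : mgf id (gaussianReal 0 v) = fun t : ℝ =>
      (1 : Polynomial ℝ).eval t * rexp (v * t ^ 2 / 2) := by
    rw [mgf_id_gaussianReal]
    simp
  have hf : ∀ t : ℝ, HasDerivAt (fun t : ℝ => rexp (v * t ^ 2 / 2))
      (rexp (v * t ^ 2 / 2) * (v * t)) t := fun t =>
    (((hasDerivAt_pow 2 t).const_mul (v : ℝ)).div_const 2).exp.congr_deriv (by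
      push_cast
      ring)
  have step : ∀ p : Polynomial ℝ, deriv (fun t : ℝ => p.eval t * rexp (v * t ^ 2 / 2)) =
      fun t => (p.derivative + Polynomial.C (v : ℝ) * Polynomial.X * p).eval t *
        rexp (v * t ^ 2 / 2) := fun p => by
    funext t
    rw [((p.hasDerivAt t).fun_mul (hf t)).deriv]
    simp
    ring
  rw [← hint, ← h, hmgf]
  simp only [iteratedDeriv_succ, iteratedDeriv_zero, step]
  simp
  ring

lemma integral_sq_gaussianReal (v : ℝ≥0) : ∫ x, x ^ 2 ∂(gaussianReal 0 v) = v := by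
  have h := variance_id_gaussianReal (μ := 0) (v := v)
  rw [variance_eq_integral (by fun_prop)] at h
  simpa using h

lemma integrable_pow_gaussianReal (v : ℝ≥0) (n : ℕ) :
    Integrable (fun x : ℝ => x ^ n) (gaussianReal 0 v) := by
  have h := (memLp_id_gaussianReal (μ := 0) (v := v) n).integrable_norm_pow'
  refine (integrable_norm_iff (by fun_prop)).1 ?_
  simpa using h

section Moments

variable {Ω : Type*} [MeasurableSpace Ω] {P : Measure Ω}

lemma aemeasurable_of_map_gaussianReal {X : Ω → ℝ} {m : ℝ} {v : ℝ≥0}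
    (h : Measure.map X P = gaussianReal m v) : AEMeasurable X P :=
  AEMeasurable.of_map_ne_zero (by rw [h]; exact IsProbabilityMeasure.ne_zero _)

lemma integrable_pow_of_map_gaussianReal {X : Ω → ℝ} {v : ℝ≥0}
    (h : Measure.map X P = gaussianReal 0 v) (n : ℕ) : Integrable (fun ω => X ω ^ n) P := by
  have h' := integrable_pow_gaussianReal v n
  rw [← h, integrable_map_measure (by fun_prop) (aemeasurable_of_map_gaussianReal h)] at h'
  exact h'

lemma integral_sq_of_map_gaussianReal {X : Ω → ℝ} {v : ℝ≥0}
    (h : Measure.map X P = gaussianReal 0 v) : ∫ ω, X ω ^ 2 ∂P = v := by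
  rw [← integral_sq_gaussianReal v, ← h,
    integral_map (aemeasurable_of_map_gaussianReal h) (by fun_prop)]

lemma integral_pow_four_of_map_gaussianReal {X : Ω → ℝ} {v : ℝ≥0}
    (h : Measure.map X P = gaussianReal 0 v) : ∫ ω, X ω ^ 4 ∂P = 3 * (v : ℝ) ^ 2 := by
  rw [← integral_pow_four_gaussianReal v, ← h,
    integral_map (aemeasurable_of_map_gaussianReal h) (by fun_prop)]

/-- The Isserlis formula for the mixed fourth moment of a centered Gaussian pair. -/
lemma integral_sq_mul_sq_of_gaussian_pair {X Y : Ω → ℝ} {A B C : ℝ} (hA : 0 ≤ A) (hB : 0 ≤ B)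
    (h : ∀ a b : ℝ, Measure.map (fun ω => a * X ω + b * Y ω) P
      = gaussianReal 0 (a ^ 2 * A + 2 * a * b * C + b ^ 2 * B).toNNReal) :
    Integrable (fun ω => X ω ^ 2 * Y ω ^ 2) P ∧
      ∫ ω, X ω ^ 2 * Y ω ^ 2 ∂P = A * B + 2 * C ^ 2 := by
  have hX := h 1 0
  have hY := h 0 1
  have hp := h 1 1
  have hm := h 1 (-1)
  simp only [one_mul, zero_mul, add_zero, zero_add, one_pow, mul_zero, mul_one, ne_eq,
    OfNat.ofNat_ne_zero, not_false_eq_true, zero_pow, neg_mul, mul_neg, neg_sq] at hX hY hp hm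
  have eX := integral_sq_of_map_gaussianReal hX
  have eY := integral_sq_of_map_gaussianReal hY
  have ep := integral_sq_of_map_gaussianReal hp
  have em := integral_sq_of_map_gaussianReal hm
  have fX := integral_pow_four_of_map_gaussianReal hX
  have fY := integral_pow_four_of_map_gaussianReal hY
  have fp := integral_pow_four_of_map_gaussianReal hp
  have fm := integral_pow_four_of_map_gaussianReal hm
  have iX := integrable_pow_of_map_gaussianReal hX
  have iY := integrable_pow_of_map_gaussianReal hY
  have ip := integrable_pow_of_map_gaussianReal hp
  have im := integrable_pow_of_map_gaussianReal hm
  rw [Real.coe_toNNReal _ hA] at eX fX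
  rw [Real.coe_toNNReal _ hB] at eY fY
  rw [Real.coe_toNNReal'] at ep fp em fm
  have par : (∫ ω, (X ω + Y ω) ^ 2 ∂P) + ∫ ω, (X ω + -Y ω) ^ 2 ∂P = 2 * A + 2 * B := by
    rw [← eX, ← eY, ← integral_const_mul, ← integral_const_mul, ← integral_add (ip 2) (im 2),
      ← integral_add ((iX 2).const_mul 2) ((iY 2).const_mul 2)]
    congr 1
    funext ω
    ring
  rw [ep, em] at par
  have p1 : 0 ≤ A + 2 * C + B := by
    by_contra! hneg
    rw [max_eq_right hneg.le, max_eq_left (by linarith)] at par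
    linarith
  have p2 : 0 ≤ A + -(2 * C) + B := by
    by_contra! hneg
    rw [max_eq_right hneg.le, max_eq_left (by linarith)] at par
    linarith
  rw [max_eq_left p1] at fp
  rw [max_eq_left p2] at fm
  have key : (fun ω => X ω ^ 2 * Y ω ^ 2) = fun ω => (1 / 12 : ℝ) *
      (((X ω + Y ω) ^ 4 + (X ω + -Y ω) ^ 4) - (2 * X ω ^ 4 + 2 * Y ω ^ 4)) := by
    funext ω
    ring
  have i1 := (ip 4).fun_add (im 4)
  have i2 := ((iX 4).const_mul 2).fun_add ((iY 4).const_mul 2)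
  rw [key]
  refine ⟨(i1.sub i2).const_mul _, ?_⟩
  rw [integral_const_mul, integral_sub i1 i2, integral_add (ip 4) (im 4),
    integral_add ((iX 4).const_mul 2) ((iY 4).const_mul 2), integral_const_mul,
    integral_const_mul, fX, fY, fp, fm]
  ring

/-- Fubini for a nonnegative family whose sections have a known integrable mean. -/
lemma integral_integral_of_nonneg [SFinite P] {ι : Type*} [MeasurableSpace ι] {μ : Measure ι}
    [SFinite μ] {F : Ω → ι → ℝ} {m : ι → ℝ} (hF : Measurable (Function.uncurry F))
    (h0 : ∀ ω y, 0 ≤ F ω y)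
    (h : ∀ᵐ y ∂μ, Integrable (fun ω => F ω y) P ∧ ∫ ω, F ω y ∂P = m y) (hm : Integrable m μ) :
    Integrable (fun ω => ∫ y, F ω y ∂μ) P ∧ ∫ ω, ∫ y, F ω y ∂μ ∂P = ∫ y, m y ∂μ := by
  have hI : Integrable (Function.uncurry F) (P.prod μ) := by
    rw [integrable_prod_iff' hF.aestronglyMeasurable]
    refine ⟨h.mono fun y hy => hy.1, hm.congr (h.mono fun y hy => ?_)⟩
    rw [← hy.2]
    refine integral_congr_ae (ae_of_all _ fun ω => ?_)
    simp [Function.uncurry, abs_of_nonneg (h0 ω y)]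
  refine ⟨hI.integral_prod_left, ?_⟩
  rw [integral_integral_swap hI]
  exact integral_congr_ae (h.mono fun y hy => hy.2)

end Moments

section Convergence

/-- If `S` is monotone and divergent, there are two index sequences, along which `S` grows at
least quadratically, such that `d N / S N` converges for every monotone nonnegative `d` for which
it converges to the same limit along both of them. -/
lemma exists_subseq_forall_tendsto_div {S : ℕ → ℝ} (hS : Monotone S)
    (hlim : Tendsto S atTop atTop) :
    ∃ n m : ℕ → ℕ, (∀ j : ℕ, (j : ℝ) ^ 2 ≤ S (n j)) ∧ (∀ j : ℕ, (j : ℝ) ^ 2 ≤ S (m j)) ∧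
      ∀ (d : ℕ → ℝ) (c : ℝ), Monotone d → (∀ N, 0 ≤ d N) →
        Tendsto (fun j => d (n j) / S (n j)) atTop (nhds c) →
        Tendsto (fun j => d (m j) / S (m j)) atTop (nhds c) →
        Tendsto (fun N => d N / S N) atTop (nhds c) := by
  classical
  have hex : ∀ j : ℕ, ∃ n, (j : ℝ) ^ 2 ≤ S n := fun j =>
    (hlim.eventually_ge_atTop _).exists
  set n : ℕ → ℕ := fun j => Nat.find (hex j) with hn
  have hSn : ∀ j : ℕ, (j : ℝ) ^ 2 ≤ S (n j) := fun j => Nat.find_spec (hex j)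
  set m : ℕ → ℕ := fun j => max (n j) (n (j + 1) - 1) with hm
  refine ⟨n, m, hSn, fun j => (hSn j).trans (hS (le_max_left _ _)), fun d c hd hd0 hdn hdm => ?_⟩
  set J : ℕ → ℕ := fun N => ⌊√(S N)⌋₊ with hJ
  have hJlim : Tendsto J atTop atTop :=
    tendsto_nat_floor_atTop.comp (tendsto_sqrt_atTop.comp hlim)
  have hratio : Tendsto (fun j : ℕ => (j : ℝ) ^ 2 / ((j : ℝ) + 1) ^ 2) atTop (nhds 1) := by
    have := (tendsto_natCast_div_add_atTop (𝕜 := ℝ) 1).pow 2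
    simpa [div_pow] using this
  have hratio' : Tendsto (fun j : ℕ => ((j : ℝ) + 1) ^ 2 / (j : ℝ) ^ 2) atTop (nhds 1) := by
    simpa using hratio.inv₀ one_ne_zero
  have hlow := (hdn.mul hratio).comp hJlim
  have hupp := (hdm.mul hratio').comp hJlim
  rw [mul_one] at hlow hupp
  refine tendsto_of_tendsto_of_tendsto_of_le_of_le' hlow hupp ?_ ?_
  all_goals
    filter_upwards [hJlim.eventually_ge_atTop 1, hlim.eventually_gt_atTop 0] with N hN hpos
    have hJ1 : (0 : ℝ) < J N := by exact_mod_cast hN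
    have hle : (J N : ℝ) ^ 2 ≤ S N := by
      have := Nat.floor_le (Real.sqrt_nonneg (S N))
      calc (J N : ℝ) ^ 2 ≤ √(S N) ^ 2 := by gcongr
        _ = S N := Real.sq_sqrt hpos.le
    have hlt : S N < ((J N : ℝ) + 1) ^ 2 := by
      have := Nat.lt_floor_add_one (√(S N))
      calc S N = √(S N) ^ 2 := (Real.sq_sqrt hpos.le).symm
        _ < ((J N : ℝ) + 1) ^ 2 := by gcongr
    have hnN : n (J N) ≤ N := Nat.find_min' (hex (J N)) hle
    have hSn' := hSn (J N)
    simp only [Function.comp_apply]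
  · have hs : 0 < S (n (J N)) := lt_of_lt_of_le (by positivity) hSn'
    have h1 : d (n (J N)) ≤ d N := hd hnN
    calc d (n (J N)) / S (n (J N)) * ((J N : ℝ) ^ 2 / ((J N : ℝ) + 1) ^ 2)
        ≤ d N / (J N : ℝ) ^ 2 * ((J N : ℝ) ^ 2 / ((J N : ℝ) + 1) ^ 2) := by
          have := hd0 N
          gcongr
      _ = d N / ((J N : ℝ) + 1) ^ 2 := by field_simp
      _ ≤ d N / S N := by
          have := hd0 N
          gcongr
  · have hNm : N ≤ m (J N) := by
      have : N < n (J N + 1) := by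
        by_contra! hcon
        have h2 := (hSn (J N + 1)).trans (hS hcon)
        push_cast at h2
        linarith
      exact le_trans (by omega) (le_max_right _ _)
    have hSm : S (m (J N)) < ((J N : ℝ) + 1) ^ 2 := by
      rcases max_choice (n (J N)) (n (J N + 1) - 1) with h | h
      · simp only [hm, h]
        exact (hS hnN).trans_lt hlt
      · simp only [hm, h]
        rcases Nat.eq_zero_or_pos (n (J N + 1)) with h0 | h0
        · rw [h0]
          exact (hS (Nat.zero_le _)).trans_lt hlt
        · have : ¬ ((J N + 1 : ℕ) : ℝ) ^ 2 ≤ S (n (J N + 1) - 1) :=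
            Nat.find_min (hex (J N + 1)) (Nat.sub_lt h0 one_pos)
          push_cast at this
          exact not_le.1 this
    have hs : 0 < S (m (J N)) := hpos.trans_le (hS hNm)
    have h1 : d N ≤ d (m (J N)) := hd hNm
    calc d N / S N ≤ d (m (J N)) / (J N : ℝ) ^ 2 := by
          have := hd0 N
          have := hd0 (m (J N))
          gcongr
      _ = d (m (J N)) / ((J N : ℝ) + 1) ^ 2 * (((J N : ℝ) + 1) ^ 2 / (J N : ℝ) ^ 2) := by
          field_simp
      _ ≤ d (m (J N)) / S (m (J N)) * (((J N : ℝ) + 1) ^ 2 / (J N : ℝ) ^ 2) := by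
          have := hd0 (m (J N))
          gcongr

/-- Weighted Cesàro means. -/
lemma tendsto_sum_mul_div_sum {b r : ℕ → ℝ} {c : ℝ} (hb : ∀ k, 0 ≤ b k)
    (hlim : Tendsto (fun N => ∑ k ∈ Finset.range N, b k) atTop atTop)
    (hr : Tendsto r atTop (nhds c)) :
    Tendsto (fun N => (∑ k ∈ Finset.range N, b k * r k) / ∑ k ∈ Finset.range N, b k)
      atTop (nhds c) := by
  have ho : (fun k => b k * (r k - c)) =o[atTop] b := by
    have h1 : (fun k => r k - c) =o[atTop] (fun _ => (1 : ℝ)) := by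
      rw [Asymptotics.isLittleO_one_iff]
      simpa using hr.sub_const c
    simpa using (Asymptotics.isBigO_refl b atTop).mul_isLittleO h1
  have h2 := (ho.sum_range hb hlim).tendsto_div_nhds_zero.add_const c
  rw [zero_add] at h2
  refine h2.congr' ?_
  filter_upwards [hlim.eventually_gt_atTop 0] with N hN
  simp only [mul_sub, Finset.sum_sub_distrib, ← Finset.sum_mul]
  field_simp
  ring

variable {Ω : Type*} [MeasurableSpace Ω] {P : Measure Ω}

lemma ae_tendsto_zero_of_integral_sq_le {Z : ℕ → Ω → ℝ} {a : ℕ → ℝ}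
    (hint : ∀ j, Integrable (fun ω => Z j ω ^ 2) P) (hle : ∀ j, ∫ ω, Z j ω ^ 2 ∂P ≤ a j)
    (ha : Summable a) : ∀ᵐ ω ∂P, Tendsto (fun j => Z j ω) atTop (nhds 0) := by
  have hmeas : ∀ j, AEMeasurable (fun ω => ENNReal.ofReal (Z j ω ^ 2)) P := fun j =>
    (hint j).aestronglyMeasurable.aemeasurable.ennreal_ofReal
  have hfin : ∫⁻ ω, ∑' j, ENNReal.ofReal (Z j ω ^ 2) ∂P ≠ ∞ := by
    rw [lintegral_tsum hmeas]
    have hs : Summable fun j => ∫ ω, Z j ω ^ 2 ∂P :=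
      ha.of_nonneg_of_le (fun j => integral_nonneg fun ω => sq_nonneg _) hle
    have heq : ∀ j, ∫⁻ ω, ENNReal.ofReal (Z j ω ^ 2) ∂P
        = ENNReal.ofReal (∫ ω, Z j ω ^ 2 ∂P) := fun j =>
      (ofReal_integral_eq_lintegral_ofReal (hint j) (ae_of_all _ fun ω => sq_nonneg _)).symm
    simp only [heq]
    exact hs.tsum_ofReal_ne_top
  filter_upwards [ae_lt_top' (AEMeasurable.tsum hmeas) hfin] with ω hω
  have h0 := ENNReal.tendsto_atTop_zero_of_tsum_ne_top hω.ne
  have h1 : Tendsto (fun j => Z j ω ^ 2) atTop (nhds 0) := by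
    have := (ENNReal.tendsto_toReal ENNReal.zero_ne_top).comp h0
    simpa [Function.comp_def, ENNReal.toReal_ofReal, sq_nonneg] using this
  rw [tendsto_zero_iff_abs_tendsto_zero]
  have h2 := h1.sqrt
  simpa [Real.sqrt_sq_eq_abs, Function.comp_def] using h2

/-- A strong law of large numbers for weighted sums of nonnegative, pairwise uncorrelated
variables, normalized by a divergent series controlling the variances. -/
lemma ae_tendsto_weighted_sum_div [IsProbabilityMeasure P] {Q : ℕ → Ω → ℝ}
    {w e V b r : ℕ → ℝ} {c K : ℝ}
    (hQ0 : ∀ k ω, 0 ≤ Q k ω) (hw : ∀ k, 0 ≤ w k) (hb : ∀ k, 0 ≤ b k)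
    (hQint : ∀ k, Integrable (Q k) P) (hQe : ∀ k, ∫ ω, Q k ω ∂P = e k)
    (hQQint : ∀ j k, Integrable (fun ω => Q j ω * Q k ω) P)
    (hQQ : ∀ j k, ∫ ω, Q j ω * Q k ω ∂P = e j * e k + if j = k then V k else 0)
    (hlim : Tendsto (fun N => ∑ k ∈ Finset.range N, b k) atTop atTop)
    (hr : Tendsto r atTop (nhds c)) (hwe : ∀ k, w k * e k = b k * r k)
    (hwV : ∀ k, w k ^ 2 * V k ≤ K * b k) :
    ∀ᵐ ω ∂P, Tendsto (fun N => (∑ k ∈ Finset.range N, w k * Q k ω) /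
      ∑ k ∈ Finset.range N, b k) atTop (nhds c) := by
  set S : ℕ → ℝ := fun N => ∑ k ∈ Finset.range N, b k with hSdef
  have hS : Monotone S := fun i j hij =>
    Finset.sum_le_sum_of_subset_of_nonneg (Finset.range_mono hij) fun k _ _ => hb k
  obtain ⟨n, m, hn, hm, hconv⟩ := exists_subseq_forall_tendsto_div hS hlim
  set R : ℕ → Ω → ℝ := fun k ω => w k * (Q k ω - e k) with hR
  have hRRint : ∀ j k, Integrable (fun ω => R j ω * R k ω) P := fun j k => by
    have : (fun ω => R j ω * R k ω) = fun ω => w j * w k *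
        (Q j ω * Q k ω - e k * Q j ω - e j * Q k ω + e j * e k) := by
      funext ω
      simp only [hR]
      ring
    rw [this]
    have h1 := hQQint j k
    have h2 := hQint j
    have h3 := hQint k
    fun_prop
  have hRR : ∀ j k, ∫ ω, R j ω * R k ω ∂P = if j = k then w k ^ 2 * V k else 0 := fun j k => by
    have h1 := hQQint j k
    have h2 := hQint j
    have h3 := hQint k
    have : (fun ω => R j ω * R k ω) = fun ω => w j * w k *
        (Q j ω * Q k ω - e k * Q j ω - e j * Q k ω + e j * e k) := by
      funext ω
      simp only [hR]
      ring
    rw [this, integral_const_mul, integral_add (by fun_prop) (by fun_prop),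
      integral_sub (by fun_prop) (by fun_prop), integral_sub (by fun_prop) (by fun_prop),
      integral_const_mul, integral_const_mul, hQQ, hQe, hQe, integral_const,
      probReal_univ, one_smul]
    split_ifs with hjk
    · subst hjk
      ring
    · ring
  have hsq : ∀ (N : ℕ) ω, (∑ k ∈ Finset.range N, R k ω) ^ 2 =
      ∑ j ∈ Finset.range N, ∑ k ∈ Finset.range N, R j ω * R k ω := fun N ω => by
    rw [sq, Finset.sum_mul_sum]
  have hvarint : ∀ N : ℕ, Integrable (fun ω => (∑ k ∈ Finset.range N, R k ω) ^ 2) P := fun N => by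
    simp only [hsq]
    exact integrable_finsetSum _ fun j _ => integrable_finsetSum _ fun k _ => hRRint j k
  have hvar : ∀ N : ℕ, ∫ ω, (∑ k ∈ Finset.range N, R k ω) ^ 2 ∂P ≤ K * S N := fun N => by
    simp only [hsq]
    rw [integral_finsetSum _ fun j _ => integrable_finsetSum _ fun k _ => hRRint j k]
    simp_rw [integral_finsetSum _ fun k _ => hRRint _ k, hRR]
    simp only [Finset.sum_ite_eq, hSdef, Finset.mul_sum]
    refine Finset.sum_le_sum fun j hj => ?_
    rw [if_pos hj]
    exact hwV j
  have hmean := tendsto_sum_mul_div_sum hb hlim hr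
  have hsub : ∀ i : ℕ → ℕ, (∀ j : ℕ, (j : ℝ) ^ 2 ≤ S (i j)) → ∀ᵐ ω ∂P,
      Tendsto (fun j => (∑ k ∈ Finset.range (i j), w k * Q k ω) / S (i j)) atTop (nhds c) := by
    intro i hi
    have hpos : ∀ j : ℕ, 0 < S (i (j + 1)) := fun j =>
      lt_of_lt_of_le (by positivity) (hi (j + 1))
    have hK : 0 ≤ K := by
      have h1 := (integral_nonneg fun ω => sq_nonneg _).trans (hvar (i 1))
      exact nonneg_of_mul_nonneg_left h1 (hpos 0)
    have hz := ae_tendsto_zero_of_integral_sq_le (P := P)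
      (Z := fun j ω => (∑ k ∈ Finset.range (i (j + 1)), R k ω) / S (i (j + 1)))
      (a := fun j => K * (1 / ((j + 1 : ℕ) : ℝ) ^ 2))
      (fun j => by
        simp only [div_pow]
        exact (hvarint _).div_const _)
      (fun j => by
        have hp := hpos j
        simp only [div_pow]
        rw [integral_div]
        calc (∫ ω, (∑ k ∈ Finset.range (i (j + 1)), R k ω) ^ 2 ∂P) / S (i (j + 1)) ^ 2
            ≤ K * S (i (j + 1)) / S (i (j + 1)) ^ 2 := by
              gcongr
              exact hvar _
          _ = K * (1 / S (i (j + 1))) := by field_simp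
          _ ≤ K * (1 / ((j + 1 : ℕ) : ℝ) ^ 2) := by
              gcongr
              exact hi (j + 1))
      (((summable_nat_add_iff 1).2 (Real.summable_one_div_nat_pow.2 one_lt_two)).mul_left K)
    have hi_lim : Tendsto (fun j => i (j + 1)) atTop atTop := by
      have h1 : Tendsto (fun j => S (i j)) atTop atTop :=
        tendsto_atTop_mono hi ((tendsto_pow_atTop two_ne_zero).comp tendsto_natCast_atTop_atTop)
      refine (tendsto_add_atTop_iff_nat 1).2 (tendsto_atTop.2 fun B => ?_)
      filter_upwards [h1.eventually_gt_atTop (S B)] with j hj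
      by_contra! hlt
      exact absurd (hS hlt.le) (not_le.2 hj)
    filter_upwards [hz] with ω hω
    rw [← tendsto_add_atTop_iff_nat 1]
    have h2 := hω.add (hmean.comp hi_lim)
    rw [zero_add] at h2
    refine h2.congr fun j => ?_
    simp only [Function.comp_apply, hSdef, hR, mul_sub, hwe, Finset.sum_sub_distrib]
    rw [← add_div, sub_add_cancel]
  filter_upwards [hsub n hn, hsub m hm] with ω h1 h2
  refine hconv (fun N => ∑ k ∈ Finset.range N, w k * Q k ω) c (fun i j hij => ?_) (fun N => ?_) h1 h2
  · exact Finset.sum_le_sum_of_subset_of_nonneg (Finset.range_mono hij)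
      fun k _ _ => mul_nonneg (hw k) (hQ0 k ω)
  · exact Finset.sum_nonneg fun k _ => mul_nonneg (hw k) (hQ0 k ω)

end Convergence

section OrnsteinUhlenbeck

lemma ouCov_comm (θ σ ν q s t : ℝ) : ouCov θ σ ν q s t = ouCov θ σ ν q t s := by
  simp only [ouCov, abs_sub_comm t s, add_comm t s]

lemma continuous_ouCov (θ σ ν q : ℝ) :
    Continuous fun z : ℝ × ℝ => ouCov θ σ ν q z.1 z.2 := by
  unfold ouCov
  fun_prop

lemma ouCov_nonneg {θ σ ν q s t : ℝ} (hθ : 0 < θ) (hν : 0 < ν) (hs : 0 ≤ s) (ht : 0 ≤ t) :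
    0 ≤ ouCov θ σ ν q s t := by
  have h1 : |t - s| ≤ t + s := abs_le.2 ⟨by linarith, by linarith⟩
  have h2 : rexp (-(θ * ν * (t + s))) ≤ rexp (-(θ * ν * |t - s|)) := by gcongr
  exact mul_nonneg (by positivity) (sub_nonneg.2 h2)

lemma ouCov_le {θ σ ν q s t : ℝ} (hθ : 0 < θ) (hν : 0 < ν) :
    ouCov θ σ ν q s t ≤ σ ^ 2 * q ^ 2 / (2 * θ * ν) * rexp (-(θ * ν * |t - s|)) := by
  unfold ouCov
  gcongr
  exact sub_le_self _ (Real.exp_pos _).le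

lemma ouCov_le_const {θ σ ν q s t : ℝ} (hθ : 0 < θ) (hν : 0 < ν) :
    ouCov θ σ ν q s t ≤ σ ^ 2 * q ^ 2 / (2 * θ * ν) := by
  refine (ouCov_le hθ hν).trans (mul_le_of_le_one_right (by positivity) ?_)
  exact Real.exp_le_one_iff.2 (neg_nonpos.2 (by positivity))

lemma integral_exp_neg_mul_abs_sub_le {c : ℝ} (hc : 0 < c) (t : ℝ) (A : Set ℝ) :
    ∫ s in A, rexp (-(c * |t - s|)) ≤ 2 / c := by
  have hI : Integrable fun x : ℝ => rexp (-(c * |x|)) := by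
    have h1 : IntegrableOn (fun x : ℝ => rexp (-c * x)) (Set.Ioi 0) := by
      simpa using integrableOn_exp_mul_Ioi (neg_lt_zero.2 hc) 0
    have h2 : IntegrableOn (fun x : ℝ => rexp (c * x)) (Set.Iic 0) :=
      integrableOn_exp_mul_Iic hc 0
    rw [← integrableOn_univ, ← Set.Iic_union_Ioi (a := (0 : ℝ))]
    refine IntegrableOn.union (h2.congr_fun (fun x hx => ?_) measurableSet_Iic)
      (h1.congr_fun (fun x hx => ?_) measurableSet_Ioi)
    · simp [abs_of_nonpos (Set.mem_Iic.1 hx)]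
    · simp [abs_of_pos (Set.mem_Ioi.1 hx)]
  calc ∫ s in A, rexp (-(c * |t - s|)) ≤ ∫ s, rexp (-(c * |t - s|)) :=
        setIntegral_le_integral (hI.comp_sub_left t) (ae_of_all _ fun s => (Real.exp_pos _).le)
    _ = ∫ x, rexp (-(c * |x|)) := integral_sub_left_eq_self (fun x => rexp (-(c * |x|))) _ t
    _ = 2 * ∫ x in Set.Ioi (0 : ℝ), rexp (-(c * x)) :=
        integral_comp_abs (f := fun x => rexp (-(c * x)))
    _ = 2 / c := by
        have := integral_exp_mul_Ioi (neg_lt_zero.2 hc) 0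
        simp only [neg_mul] at this
        rw [this]
        simp
        ring

lemma integral_ouCov_diag {θ σ ν q T : ℝ} (hθ : 0 < θ) (hν : 0 < ν) :
    ∫ t in (0 : ℝ)..T, ouCov θ σ ν q t t =
      σ ^ 2 * q ^ 2 / (2 * θ * ν) * (T - (1 - rexp (-(2 * θ * ν * T))) / (2 * θ * ν)) := by
  have hne : -(2 * θ * ν) ≠ 0 := neg_ne_zero.2 (by positivity)
  have h : ∀ t, ouCov θ σ ν q t t =
      σ ^ 2 * q ^ 2 / (2 * θ * ν) * (1 - rexp (-(2 * θ * ν) * t)) := fun t => by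
    simp only [ouCov, sub_self, abs_zero, mul_zero, neg_zero, Real.exp_zero]
    ring_nf
  simp only [h]
  rw [intervalIntegral.integral_const_mul, intervalIntegral.integral_sub (by simp)
    (by exact Continuous.intervalIntegrable (by fun_prop) _ _),
    intervalIntegral.integral_comp_mul_left (fun x => rexp x) hne, integral_exp]
  simp
  left
  ring_nf

lemma integral_ouCov_sq_le {θ σ ν q T : ℝ} (hθ : 0 < θ) (hν : 0 < ν) (hT : 0 ≤ T) :
    ∫ z, ouCov θ σ ν q z.1 z.2 ^ 2
      ∂((volume.restrict (Set.Ioc 0 T)).prod (volume.restrict (Set.Ioc 0 T))) ≤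
      (σ ^ 2 * q ^ 2 / (2 * θ * ν)) ^ 2 * (T / (θ * ν)) := by
  set κ := σ ^ 2 * q ^ 2 / (2 * θ * ν) with hκ
  have hκ0 : 0 ≤ κ := by positivity
  have hmem : ∀ᵐ t ∂(volume.restrict (Set.Ioc 0 T)), t ∈ Set.Ioc 0 T :=
    ae_restrict_mem measurableSet_Ioc
  have hmem2 : ∀ᵐ z ∂((volume.restrict (Set.Ioc 0 T)).prod (volume.restrict (Set.Ioc 0 T))),
      z.1 ∈ Set.Ioc 0 T ∧ z.2 ∈ Set.Ioc 0 T :=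
    (Measure.quasiMeasurePreserving_fst.ae hmem).and (Measure.quasiMeasurePreserving_snd.ae hmem)
  have hle : ∀ s t : ℝ, 0 ≤ s → 0 ≤ t →
      ouCov θ σ ν q s t ^ 2 ≤ κ ^ 2 * rexp (-(2 * (θ * ν) * |s - t|)) := fun s t hs ht => by
    calc ouCov θ σ ν q s t ^ 2 ≤ (κ * rexp (-(θ * ν * |t - s|))) ^ 2 := by
          gcongr
          · exact ouCov_nonneg hθ hν hs ht
          · exact ouCov_le hθ hν
      _ = κ ^ 2 * rexp (-(2 * (θ * ν) * |s - t|)) := by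
          rw [mul_pow, ← Real.exp_nat_mul, abs_sub_comm]
          push_cast
          ring_nf
  have hI : Integrable (fun z : ℝ × ℝ => rexp (-(2 * (θ * ν) * |z.1 - z.2|)))
      ((volume.restrict (Set.Ioc 0 T)).prod (volume.restrict (Set.Ioc 0 T))) := by
    refine Integrable.of_bound (Continuous.aestronglyMeasurable (by fun_prop)) 1
      (ae_of_all _ fun z => ?_)
    rw [Real.norm_of_nonneg (Real.exp_pos _).le]
    exact Real.exp_le_one_iff.2 (neg_nonpos.2 (by positivity))
  calc _ ≤ ∫ z : ℝ × ℝ, κ ^ 2 * rexp (-(2 * (θ * ν) * |z.1 - z.2|))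
        ∂((volume.restrict (Set.Ioc 0 T)).prod (volume.restrict (Set.Ioc 0 T))) :=
        integral_mono_of_nonneg (ae_of_all _ fun z => sq_nonneg _) (hI.const_mul _)
          (hmem2.mono fun z hz => hle _ _ hz.1.1.le hz.2.1.le)
    _ = κ ^ 2 * ∫ s in Set.Ioc 0 T, ∫ t in Set.Ioc 0 T, rexp (-(2 * (θ * ν) * |s - t|)) := by
        rw [integral_const_mul, integral_prod _ hI]
    _ ≤ κ ^ 2 * ∫ s in Set.Ioc 0 T, 2 / (2 * (θ * ν)) := by
        refine mul_le_mul_of_nonneg_left ?_ (sq_nonneg κ)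
        refine integral_mono_of_nonneg (ae_of_all _ fun s => ?_)
          (integrable_const _) (ae_of_all _ fun s => ?_)
        · exact integral_nonneg fun t => (Real.exp_pos _).le
        · exact integral_exp_neg_mul_abs_sub_le (by positivity) s _
    _ = κ ^ 2 * (T / (θ * ν)) := by
        simp [hT]
        field_simp
        simp

variable {Ω : Type*} [MeasurableSpace Ω] {P : Measure Ω} {v : ℕ → ℝ → Ω → ℝ} {θ σ T : ℝ}
  {ν q : ℕ → ℝ}

lemma IsIndepOUFamily.map_pair (hOU : IsIndepOUFamily P v θ σ ν q T) (j k : ℕ) {s t : ℝ}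
    (hs : s ∈ Set.Icc 0 T) (ht : t ∈ Set.Icc 0 T) (a b : ℝ) :
    Measure.map (fun ω => a * v j s ω + b * v k t ω) P = gaussianReal 0
      (a ^ 2 * ouCov θ σ (ν j) (q j) s s +
        2 * a * b * (if j = k then ouCov θ σ (ν j) (q j) s t else 0) +
        b ^ 2 * ouCov θ σ (ν k) (q k) t t).toNNReal := by
  have h := hOU 2 ![j, k] ![s, t] (by intro i; fin_cases i <;> simpa) ![a, b]
  simp only [Fin.sum_univ_two, Matrix.cons_val_zero, Matrix.cons_val_one, if_true] at h
  rw [h]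
  congr 2
  by_cases hjk : j = k
  · subst hjk
    simp only [if_true, ouCov_comm θ σ (ν j) (q j) t s]
    ring
  · simp only [hjk, Ne.symm hjk, if_false]
    ring

lemma IsIndepOUFamily.moments (hOU : IsIndepOUFamily P v θ σ ν q T) (hθ : 0 < θ)
    (hν : ∀ k, 0 < ν k) (j k : ℕ) {s t : ℝ} (hs : s ∈ Set.Icc 0 T) (ht : t ∈ Set.Icc 0 T) :
    Integrable (fun ω => v j s ω ^ 2 * v k t ω ^ 2) P ∧
      ∫ ω, v j s ω ^ 2 * v k t ω ^ 2 ∂P =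
        ouCov θ σ (ν j) (q j) s s * ouCov θ σ (ν k) (q k) t t +
          2 * (if j = k then ouCov θ σ (ν j) (q j) s t else 0) ^ 2 :=
  integral_sq_mul_sq_of_gaussian_pair (ouCov_nonneg hθ (hν j) hs.1 hs.1)
    (ouCov_nonneg hθ (hν k) ht.1 ht.1) (hOU.map_pair j k hs ht)

lemma IsIndepOUFamily.second_moment (hOU : IsIndepOUFamily P v θ σ ν q T) (hθ : 0 < θ)
    (hν : ∀ k, 0 < ν k) (k : ℕ) {t : ℝ} (ht : t ∈ Set.Icc 0 T) :
    Integrable (fun ω => v k t ω ^ 2) P ∧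
      ∫ ω, v k t ω ^ 2 ∂P = ouCov θ σ (ν k) (q k) t t := by
  have h := hOU.map_pair k k ht ht 1 0
  simp only [one_mul, zero_mul, add_zero, one_pow, mul_zero, ne_eq,
    OfNat.ofNat_ne_zero, not_false_eq_true, zero_pow] at h
  refine ⟨integrable_pow_of_map_gaussianReal h 2, ?_⟩
  rw [integral_sq_of_map_gaussianReal h, Real.coe_toNNReal _ (ouCov_nonneg hθ (hν k) ht.1 ht.1)]

/-- Law of large numbers for weighted sums of `∫ v k t ^ 2 ∂μ`, with `μ` a finite measure
carried by the observation interval. -/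
lemma IsIndepOUFamily.ae_tendsto_quadratic [IsProbabilityMeasure P]
    (hOU : IsIndepOUFamily P v θ σ ν q T) (hθ : 0 < θ) (hν : ∀ k, 0 < ν k)
    (hcont : ∀ k ω, Continuous fun t => v k t ω) (hmeas : ∀ k t, Measurable (v k t))
    (μ : Measure ℝ) [IsFiniteMeasure μ] (hμ : ∀ᵐ t ∂μ, t ∈ Set.Icc 0 T)
    {w b r : ℕ → ℝ} {c K : ℝ} (hw : ∀ k, 0 ≤ w k) (hb : ∀ k, 0 ≤ b k)
    (hlim : Tendsto (fun N => ∑ k ∈ Finset.range N, b k) atTop atTop)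
    (hr : Tendsto r atTop (nhds c))
    (hwe : ∀ k, w k * ∫ t, ouCov θ σ (ν k) (q k) t t ∂μ = b k * r k)
    (hwV : ∀ k, w k ^ 2 * (2 * ∫ z, ouCov θ σ (ν k) (q k) z.1 z.2 ^ 2 ∂(μ.prod μ)) ≤ K * b k) :
    ∀ᵐ ω ∂P, Tendsto (fun N => (∑ k ∈ Finset.range N, w k * ∫ t, v k t ω ^ 2 ∂μ) /
      ∑ k ∈ Finset.range N, b k) atTop (nhds c) := by
  have hμ2 : ∀ᵐ z ∂(μ.prod μ), z.1 ∈ Set.Icc 0 T ∧ z.2 ∈ Set.Icc 0 T :=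
    (Measure.quasiMeasurePreserving_fst.ae hμ).and (Measure.quasiMeasurePreserving_snd.ae hμ)
  have hjoint : ∀ k, Measurable fun p : Ω × ℝ => v k p.2 p.1 := fun k =>
    (measurable_uncurry_of_continuous_of_measurable (hcont k) (hmeas k)).comp measurable_swap
  have hbd : ∀ k {s t : ℝ}, 0 ≤ s → 0 ≤ t → ‖ouCov θ σ (ν k) (q k) s t‖ ≤
      σ ^ 2 * q k ^ 2 / (2 * θ * ν k) := fun k s t hs ht => by
    rw [Real.norm_of_nonneg (ouCov_nonneg hθ (hν k) hs ht)]
    exact ouCov_le_const hθ (hν k)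
  have hdiag_cont : ∀ k, Continuous fun t => ouCov θ σ (ν k) (q k) t t := fun k =>
    (continuous_ouCov θ σ (ν k) (q k)).comp (continuous_id.prodMk continuous_id)
  have hdiag : ∀ k, Integrable (fun t => ouCov θ σ (ν k) (q k) t t) μ := fun k =>
    Integrable.of_bound (hdiag_cont k).aestronglyMeasurable _
      (hμ.mono fun t ht => hbd k ht.1 ht.1)
  have hoff : ∀ k, Integrable (fun z : ℝ × ℝ => ouCov θ σ (ν k) (q k) z.1 z.2 ^ 2)
      (μ.prod μ) := fun k =>
    Integrable.of_bound ((continuous_ouCov θ σ (ν k) (q k)).pow 2).aestronglyMeasurable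
      ((σ ^ 2 * q k ^ 2 / (2 * θ * ν k)) ^ 2) (hμ2.mono fun z hz => by
        rw [norm_pow]
        gcongr
        exact hbd k hz.1.1 hz.2.1)
  have hoff' : ∀ j k, Integrable (fun z : ℝ × ℝ =>
      2 * (if j = k then ouCov θ σ (ν j) (q j) z.1 z.2 else 0) ^ 2) (μ.prod μ) := fun j k => by
    split_ifs
    · exact (hoff j).const_mul 2
    · simp
  have h1 := fun k => integral_integral_of_nonneg (P := P) (μ := μ)
    (F := fun ω t => v k t ω ^ 2) ((hjoint k).pow_const 2) (fun _ _ => sq_nonneg _)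
    (hμ.mono fun t ht => hOU.second_moment hθ hν k ht) (hdiag k)
  have h2 := fun j k => integral_integral_of_nonneg (P := P) (μ := μ.prod μ)
    (F := fun ω z => v j z.1 ω ^ 2 * v k z.2 ω ^ 2)
    (.fun_mul (((hjoint j).comp (measurable_fst.prodMk measurable_snd.fst)).pow_const 2)
      (((hjoint k).comp (measurable_fst.prodMk measurable_snd.snd)).pow_const 2))
    (fun _ _ => mul_nonneg (sq_nonneg _) (sq_nonneg _))
    (hμ2.mono fun z hz => hOU.moments hθ hν j k hz.1 hz.2)
    (((hdiag j).mul_prod (hdiag k)).add (hoff' j k))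
  have hprod : ∀ j k ω, ∫ z : ℝ × ℝ, v j z.1 ω ^ 2 * v k z.2 ω ^ 2 ∂(μ.prod μ) =
      (∫ t, v j t ω ^ 2 ∂μ) * ∫ t, v k t ω ^ 2 ∂μ := fun j k ω =>
    integral_prod_mul (fun t => v j t ω ^ 2) fun t => v k t ω ^ 2
  refine ae_tendsto_weighted_sum_div (P := P) (Q := fun k ω => ∫ t, v k t ω ^ 2 ∂μ)
    (e := fun k => ∫ t, ouCov θ σ (ν k) (q k) t t ∂μ)
    (V := fun k => 2 * ∫ z, ouCov θ σ (ν k) (q k) z.1 z.2 ^ 2 ∂(μ.prod μ))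
    (fun k ω => integral_nonneg fun t => sq_nonneg _) hw hb (fun k => (h1 k).1)
    (fun k => (h1 k).2) (fun j k => ?_) (fun j k => ?_) hlim hr hwe hwV
  · have := (h2 j k).1
    simp only [hprod] at this
    exact this
  · have := (h2 j k).2
    simp only [hprod] at this
    rw [this, integral_add ((hdiag j).mul_prod (hdiag k)) (hoff' j k),
      integral_prod_mul (fun t => ouCov θ σ (ν j) (q j) t t) fun t => ouCov θ σ (ν k) (q k) t t]
    split_ifs with hjk
    · rw [integral_const_mul, hjk]
    · simp

end OrnsteinUhlenbeck

section Estimator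

variable {Ω : Type*} [MeasurableSpace Ω] {P : Measure Ω}

lemma map_completion {f : Ω → ℝ} (hf : AEMeasurable f P) :
    Measure.map (α := NullMeasurableSpace Ω P) f P.completion = Measure.map f P := by
  have hf' : Measurable (α := NullMeasurableSpace Ω P) f := hf.nullMeasurable
  ext s hs
  rw [Measure.map_apply_of_aemeasurable hf hs, Measure.map_apply hf' hs]
  exact Measure.completion_apply P _

lemma IsIndepOUFamily.completion {u : ℕ → ℝ → Ω → ℝ} {θ σ T : ℝ} {ν q : ℕ → ℝ}
    (hOU : IsIndepOUFamily P u θ σ ν q T) :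
    IsIndepOUFamily (Ω := NullMeasurableSpace Ω P) P.completion u θ σ ν q T := by
  intro n k t ht a
  have h := hOU n k t ht a
  exact (map_completion (aemeasurable_of_map_gaussianReal h)).trans h

lemma IsIndepOUFamily.aemeasurable {u : ℕ → ℝ → Ω → ℝ} {θ σ T : ℝ} {ν q : ℕ → ℝ}
    (hOU : IsIndepOUFamily P u θ σ ν q T) (k : ℕ) {t : ℝ} (ht : t ∈ Set.Icc 0 T) :
    AEMeasurable (u k t) P := by
  have h := hOU.map_pair k k ht ht 1 0
  simp only [one_mul, zero_mul, add_zero] at h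
  exact aemeasurable_of_map_gaussianReal h

lemma IsIndepOUFamily.comp_injective {u : ℕ → ℝ → Ω → ℝ} {θ σ T : ℝ} {ν q : ℕ → ℝ}
    (hOU : IsIndepOUFamily P u θ σ ν q T) {f : ℕ → ℕ} (hf : Function.Injective f) :
    IsIndepOUFamily P (fun k => u (f k)) θ σ (fun k => ν (f k)) (fun k => q (f k)) T := by
  intro n k t ht
  have h := hOU n (fun i => f (k i)) t ht
  simpa only [hf.eq_iff] using h

lemma IsIndepOUFamily.congr {u v : ℕ → ℝ → Ω → ℝ} {θ σ T : ℝ} {ν q : ℕ → ℝ}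
    (hOU : IsIndepOUFamily P u θ σ ν q T) (huv : ∀ k, ∀ t ∈ Set.Icc 0 T, u k t = v k t) :
    IsIndepOUFamily P v θ σ ν q T := by
  intro n k t ht
  have h := hOU n k t ht
  simpa only [huv _ _ (ht _)] using h

lemma IsIndepOUFamily.ae_tendsto_estimator [IsProbabilityMeasure P] {v : ℕ → ℝ → Ω → ℝ}
    {θ σ T α ρ M : ℝ} {ν q : ℕ → ℝ} (hOU : IsIndepOUFamily P v θ σ ν q T)
    (hθ : 0 < θ) (hσ : 0 < σ) (hT : 0 < T) (hν : ∀ k, 0 < ν k) (hq : ∀ k, 0 < q k)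
    (hνlim : Tendsto ν atTop atTop)
    (hM : ∀ n, ν n ^ (α - 1) * q n ^ (2 * ρ + 2) ≤ M)
    (hdiv : Tendsto (fun N : ℕ => ∑ k ∈ Finset.range N, ν k ^ α * q k ^ (2 * ρ + 2))
      atTop atTop)
    (hcont : ∀ k ω, Continuous fun t => v k t ω) (hmeas : ∀ k t, Measurable (v k t)) :
    ∀ᵐ ω ∂P, Tendsto (fun N : ℕ =>
        -(∑ k ∈ Finset.range N, ν k ^ α * q k ^ (2 * ρ) *
            ((v k T ω) ^ 2 - σ ^ 2 * q k ^ 2 * T)) /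
          (2 * ∑ k ∈ Finset.range N, ν k ^ (1 + α) * q k ^ (2 * ρ) *
            ∫ t in (0 : ℝ)..T, (v k t ω) ^ 2))
      atTop (nhds θ) := by
  set a : ℕ → ℝ := fun k => ν k ^ α * q k ^ (2 * ρ) with ha
  set b : ℕ → ℝ := fun k => ν k ^ α * q k ^ (2 * ρ + 2) with hb
  have ha0 : ∀ k, 0 ≤ a k := fun k =>
    mul_nonneg (rpow_nonneg (hν k).le _) (rpow_nonneg (hq k).le _)
  have hb0 : ∀ k, 0 ≤ b k := fun k =>
    mul_nonneg (rpow_nonneg (hν k).le _) (rpow_nonneg (hq k).le _)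
  have hba : ∀ k, b k = a k * q k ^ 2 := fun k => by
    simp only [hb, ha, rpow_add (hq k), rpow_two]
    ring
  have hwa : ∀ k, ν k ^ (1 + α) * q k ^ (2 * ρ) = ν k * a k := fun k => by
    simp only [ha, rpow_add (hν k), rpow_one]
    ring
  have hbM : ∀ k, b k / ν k ≤ M := fun k => by
    refine le_trans (le_of_eq ?_) (hM k)
    simp only [hb, rpow_sub_one (hν k).ne']
    ring
  have hM0 : 0 ≤ M := (div_nonneg (hb0 0) (hν 0).le).trans (hbM 0)
  obtain ⟨B, hB⟩ := (tendsto_inv_atTop_zero.comp hνlim).bddAbove_range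
  have hB' : ∀ k, (ν k)⁻¹ ≤ B := fun k => hB ⟨k, rfl⟩
  have hexp : ∀ c : ℝ, 0 < c →
      Tendsto (fun k => (1 - rexp (-(c * ν k))) / ν k) atTop (nhds 0) := fun c hc => by
    have h1 : Tendsto (fun k => 1 - rexp (-(c * ν k))) atTop (nhds (1 - 0)) :=
      (Real.tendsto_exp_neg_atTop_nhds_zero.comp (hνlim.const_mul_atTop hc)).const_sub 1
    exact h1.div_atTop hνlim
  have hY := hOU.ae_tendsto_quadratic hθ hν hcont hmeas (Measure.dirac T)
    (by simp [ae_dirac_eq, hT.le]) (w := a) (b := b)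
    (r := fun k => σ ^ 2 / (2 * θ) * ((1 - rexp (-(2 * θ * T * ν k))) / ν k))
    (c := 0) (K := σ ^ 4 / (2 * θ ^ 2) * (M * B)) ha0 hb0 hdiv
    (by simpa using (hexp (2 * θ * T) (by positivity)).const_mul (σ ^ 2 / (2 * θ)))
    (fun k => by
      have := hν k
      have harg : θ * ν k * (T + T) = 2 * θ * T * ν k := by ring
      rw [integral_dirac, hba k]
      simp only [ouCov, sub_self, abs_zero, mul_zero, neg_zero, Real.exp_zero, harg]
      field_simp)
    (fun k => by
      have := hν k
      rw [Measure.dirac_prod_dirac, integral_dirac]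
      have hC := ouCov_nonneg (σ := σ) (q := q k) hθ (hν k) hT.le hT.le
      calc a k ^ 2 * (2 * ouCov θ σ (ν k) (q k) T T ^ 2)
          ≤ a k ^ 2 * (2 * (σ ^ 2 * q k ^ 2 / (2 * θ * ν k)) ^ 2) := by
            gcongr
            exact ouCov_le_const hθ (hν k)
        _ = σ ^ 4 / (2 * θ ^ 2) * (b k / ν k * (ν k)⁻¹) * b k := by
            rw [hba k]
            field_simp
        _ ≤ σ ^ 4 / (2 * θ ^ 2) * (M * B) * b k := by
            have := hb0 k
            gcongr
            · exact hbM k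
            · exact hB' k)
  have hX := hOU.ae_tendsto_quadratic hθ hν hcont hmeas (volume.restrict (Set.Ioc 0 T))
    ((ae_restrict_mem measurableSet_Ioc).mono fun t ht => Set.Ioc_subset_Icc_self ht)
    (w := fun k => ν k * a k) (b := b)
    (r := fun k => σ ^ 2 / (2 * θ) *
      (T - 1 / (2 * θ) * ((1 - rexp (-(2 * θ * T * ν k))) / ν k)))
    (c := σ ^ 2 / (2 * θ) * T) (K := σ ^ 4 * T / (2 * θ ^ 3) * M)
    (fun k => mul_nonneg (hν k).le (ha0 k)) hb0 hdiv
    (by simpa using ((((hexp (2 * θ * T) (by positivity)).const_mul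
      (1 / (2 * θ))).const_sub T).const_mul (σ ^ 2 / (2 * θ))))
    (fun k => by
      have := hν k
      have harg : 2 * θ * ν k * T = 2 * θ * T * ν k := by ring
      rw [← intervalIntegral.integral_of_le hT.le, integral_ouCov_diag hθ (hν k), hba k, harg]
      field_simp)
    (fun k => by
      have := hν k
      calc (ν k * a k) ^ 2 * (2 * _)
          ≤ (ν k * a k) ^ 2 *
            (2 * ((σ ^ 2 * q k ^ 2 / (2 * θ * ν k)) ^ 2 * (T / (θ * ν k)))) := by
            gcongr
            exact integral_ouCov_sq_le hθ (hν k) hT.le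
        _ = σ ^ 4 * T / (2 * θ ^ 3) * (b k / ν k) * b k := by
            rw [hba k]
            field_simp
        _ ≤ σ ^ 4 * T / (2 * θ ^ 3) * M * b k := by
            have := hb0 k
            gcongr
            exact hbM k)
  filter_upwards [hX, hY] with ω h1 h2
  simp only [integral_dirac] at h2
  have h3 := (h2.const_sub (σ ^ 2 * T)).div (h1.const_mul 2) (by positivity)
  have hlim : (σ ^ 2 * T - 0) / (2 * (σ ^ 2 / (2 * θ) * T)) = θ := by
    rw [sub_zero]
    field_simp
  rw [hlim] at h3
  refine h3.congr' ?_
  filter_upwards [hdiv.eventually_gt_atTop 0] with N hN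
  have hnum : -(∑ k ∈ Finset.range N, a k * ((v k T ω) ^ 2 - σ ^ 2 * q k ^ 2 * T)) =
      σ ^ 2 * T * (∑ k ∈ Finset.range N, b k) - ∑ k ∈ Finset.range N, a k * v k T ω ^ 2 := by
    rw [Finset.mul_sum, ← Finset.sum_sub_distrib, ← Finset.sum_neg_distrib]
    refine Finset.sum_congr rfl fun k _ => ?_
    rw [hba k]
    ring
  have hS : (∑ k ∈ Finset.range N, b k) ≠ 0 := hN.ne'
  simp only [hwa, Pi.div_apply, intervalIntegral.integral_of_le hT.le]
  rw [hnum, ← mul_div_assoc, sub_div' hS, div_div_div_cancel_right₀ hS]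

end Estimator

/-- Consistency of the modified MLE in the spectral approach: `θ̂_N → θ` a.s. as `N → ∞`. -/
theorem stmt0 {Ω : Type*} [MeasurableSpace Ω] (P : Measure Ω) [IsProbabilityMeasure P]
    (θ σ T α ρ : ℝ) (hθ : 0 < θ) (hσ : 0 < σ) (hT : 0 < T)
    (ν q : ℕ → ℝ) (hν : ∀ k, 0 < ν k) (hq : ∀ k, 0 < q k)
    (hνlim : Tendsto ν atTop atTop) (hqlim : Tendsto q atTop (nhds 0))
    (M : ℝ) (hM : ∀ n, 1 ≤ n → ν n ^ (α - 1) * q n ^ (2 * ρ + 2) ≤ M)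
    (hdiv : Tendsto (fun N : ℕ => ∑ k ∈ Finset.Icc 1 N, ν k ^ α * q k ^ (2 * ρ + 2))
      atTop atTop)
    (u : ℕ → ℝ → Ω → ℝ)
    (hcont : ∀ k ω, ContinuousOn (fun t => u k t ω) (Set.Icc 0 T))
    (hOU : IsIndepOUFamily P u θ σ ν q T) :
    ∀ᵐ ω ∂P, Tendsto (fun N : ℕ =>
        -(∑ k ∈ Finset.Icc 1 N, ν k ^ α * q k ^ (2 * ρ) *
            ((u k T ω) ^ 2 - σ ^ 2 * q k ^ 2 * T)) /
          (2 * ∑ k ∈ Finset.Icc 1 N, ν k ^ (1 + α) * q k ^ (2 * ρ) *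
            ∫ t in (0 : ℝ)..T, (u k t ω) ^ 2))
      atTop (nhds θ) := by
  have hOU' := (hOU.comp_injective (add_left_injective 1)).completion
  set v : ℕ → ℝ → NullMeasurableSpace Ω P → ℝ :=
    fun k t ω => u (k + 1) (Set.projIcc 0 T hT.le t) ω with hv
  have hproj : ∀ t ∈ Set.Icc 0 T, (Set.projIcc 0 T hT.le t : ℝ) = t := fun t ht => by
    rw [Set.projIcc_of_mem hT.le ht]
  have hvOU := hOU'.congr (v := v) fun k t ht => by
    funext ω
    simp only [hv, hproj t ht]
  have hIcc : ∀ (f : ℕ → ℝ) (N : ℕ),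
      ∑ k ∈ Finset.Icc 1 N, f k = ∑ k ∈ Finset.range N, f (k + 1) := fun f N => by
    rw [Finset.range_eq_Ico, Finset.sum_Ico_add' f 0 N 1]
    rfl
  simp only [hIcc] at hdiv ⊢
  have : IsProbabilityMeasure P.completion :=
    ⟨(Measure.completion_apply P _).trans measure_univ⟩
  have h := hvOU.ae_tendsto_estimator hθ hσ hT (fun k => hν (k + 1)) (fun k => hq (k + 1))
    ((tendsto_add_atTop_iff_nat 1).2 hνlim) (fun n => hM (n + 1) (Nat.le_add_left 1 n)) hdiv
    (fun k ω => (hcont (k + 1) ω).comp_continuous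
      (continuous_subtype_val.comp continuous_projIcc) fun t => (Set.projIcc 0 T hT.le t).2)
    (fun k t => (hOU.aemeasurable (k + 1) (Set.projIcc 0 T hT.le t).2).nullMeasurable)
  rw [Measure.ae_completion] at h
  filter_upwards [h] with ω hω
  refine hω.congr fun N => ?_
  have hint : ∀ k, ∫ t in (0 : ℝ)..T, v k t ω ^ 2 = ∫ t in (0 : ℝ)..T, u (k + 1) t ω ^ 2 :=
    fun k => intervalIntegral.integral_congr fun t ht => by
      rw [Set.uIcc_of_le hT.le] at ht
      simp only [hv, hproj t ht]
  have hend : ∀ k, v k T ω = u (k + 1) T ω := fun k => by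
    simp only [hv, hproj T ⟨hT.le, le_rfl⟩]
  simp only [hint, hend]
end
end

section
/- Let θ, σ, ν, q, T > 0 and define C(s,t) := (σ²q²/(2θν)) (e^{−θν|t−s|} − e^{−θν(t+s)}) for s, t ∈ [0,T]. Then 2 ∫_0^T ∫_0^T C(s,t)² ds dt = (σ⁴q⁴/(4θ²ν²)) ( 2T/(θν) + 2e^{−2θνT}/(θ²ν²) + e^{−4θνT}/(2θ²ν²) + 4T e^{−2θνT}/(θν) − 5/(2θ²ν²) ). -/
open MeasureTheory Real

noncomputable section

open intervalIntegral

theorem hasDerivAt_exp_affine (c d x : ℝ) :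
    HasDerivAt (fun t : ℝ => exp (c * t + d)) (c * exp (c * x + d)) x := by
  have h := (((hasDerivAt_id x).const_mul c).add_const d).exp
  simpa [mul_comm] using h

theorem integral_sq_ou_kernel_of_le {a : ℝ} (ha : a ≠ 0) {s : ℝ} (hs : 0 ≤ s) :
    ∫ t in (0 : ℝ)..s, (exp (-(a * |t - s|)) - exp (-(a * (t + s)))) ^ 2
      = (1 - exp (-4 * a * s)) / (2 * a) - 2 * s * exp (-2 * a * s) := by
  have hcongr : ∫ t in (0 : ℝ)..s, (exp (-(a * |t - s|)) - exp (-(a * (t + s)))) ^ 2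
      = ∫ t in (0 : ℝ)..s, (exp (2 * a * t + -2 * a * s) - 2 * exp (-2 * a * s)
          + exp (-2 * a * t + -2 * a * s)) := by
    refine integral_congr fun t ht => ?_
    rw [Set.uIcc_of_le hs] at ht
    simp only [abs_of_nonpos (sub_nonpos.2 ht.2), sub_sq, ← exp_nat_mul, mul_assoc (2 : ℝ),
      ← exp_add]
    push_cast
    ring_nf
  rw [hcongr, integral_eq_sub_of_hasDerivAt
    (f := fun t => exp (2 * a * t + -2 * a * s) / (2 * a) - 2 * exp (-2 * a * s) * t
      - exp (-2 * a * t + -2 * a * s) / (2 * a))]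
  · have h : exp (2 * a * s + -2 * a * s) = 1 := by simp
    have h' : exp (-2 * a * s + -2 * a * s) = exp (-4 * a * s) := by ring_nf
    simp only [h, h', mul_zero, zero_add]
    field_simp
    ring
  · intro t _
    refine ((((hasDerivAt_exp_affine (2 * a) (-2 * a * s) t).div_const (2 * a)).sub
      ((hasDerivAt_id t).const_mul (2 * exp (-2 * a * s)))).sub
      ((hasDerivAt_exp_affine (-2 * a) (-2 * a * s) t).div_const (2 * a))).congr_deriv ?_
    field_simp
    ring
  · exact (by fun_prop : Continuous _).intervalIntegrable _ _

theorem integral_sq_ou_kernel_of_ge {a : ℝ} (ha : a ≠ 0) {s T : ℝ} (hs : s ≤ T) :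
    ∫ t in s..T, (exp (-(a * |t - s|)) - exp (-(a * (t + s)))) ^ 2
      = (1 - 2 * exp (-2 * a * s) + exp (-4 * a * s)) / (2 * a)
        - exp (-2 * a * T) * (exp (2 * a * s) - 2 + exp (-2 * a * s)) / (2 * a) := by
  have hcongr : ∫ t in s..T, (exp (-(a * |t - s|)) - exp (-(a * (t + s)))) ^ 2
      = ∫ t in s..T, exp (-2 * a * t + 0) * (exp (2 * a * s) - 2 + exp (-2 * a * s)) := by
    refine integral_congr fun t ht => ?_
    rw [Set.uIcc_of_le hs] at ht
    simp only [abs_of_nonneg (sub_nonneg.2 ht.1), sub_sq, ← exp_nat_mul, mul_assoc (2 : ℝ),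
      ← exp_add, mul_add, mul_sub]
    push_cast
    ring_nf
  rw [hcongr, integral_eq_sub_of_hasDerivAt
    (f := fun t => exp (-2 * a * t + 0) / (-2 * a) * (exp (2 * a * s) - 2 + exp (-2 * a * s)))]
  · have h : exp (2 * a * s) = (exp (-2 * a * s))⁻¹ := by rw [← exp_neg]; ring_nf
    have h' : exp (-4 * a * s) = exp (-2 * a * s) ^ 2 := by rw [← exp_nat_mul]; ring_nf
    have hne := exp_ne_zero (-2 * a * s)
    simp only [h, h', add_zero]
    generalize exp (-2 * a * s) = x at hne
    field_simp
    ring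
  · intro t _
    refine (((hasDerivAt_exp_affine (-2 * a) 0 t).div_const (-2 * a)).mul_const
      (exp (2 * a * s) - 2 + exp (-2 * a * s))).congr_deriv ?_
    field_simp
  · exact (by fun_prop : Continuous _).intervalIntegrable _ _

theorem integral_sq_ou_kernel {a : ℝ} (ha : a ≠ 0) {s T : ℝ} (h0 : 0 ≤ s) (hT : s ≤ T) :
    ∫ t in (0 : ℝ)..T, (exp (-(a * |t - s|)) - exp (-(a * (t + s)))) ^ 2
      = (1 - exp (-2 * a * s)) / a - 2 * s * exp (-2 * a * s)
        - exp (-2 * a * T) * (exp (2 * a * s) - 2 + exp (-2 * a * s)) / (2 * a) := by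
  have hc : Continuous fun t : ℝ => (exp (-(a * |t - s|)) - exp (-(a * (t + s)))) ^ 2 := by
    fun_prop
  rw [← integral_add_adjacent_intervals (hc.intervalIntegrable 0 s) (hc.intervalIntegrable s T),
    integral_sq_ou_kernel_of_le ha h0, integral_sq_ou_kernel_of_ge ha hT]
  field_simp
  ring

theorem integral_integral_sq_ou_kernel {a T : ℝ} (ha : a ≠ 0) (hT : 0 ≤ T) :
    ∫ s in (0 : ℝ)..T, ∫ t in (0 : ℝ)..T, (exp (-(a * |t - s|)) - exp (-(a * (t + s)))) ^ 2
      = T / a + 2 * T * exp (-2 * a * T) / a + exp (-2 * a * T) / a ^ 2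
        + exp (-2 * a * T) ^ 2 / (4 * a ^ 2) - 5 / (4 * a ^ 2) := by
  have hcongr : ∫ s in (0 : ℝ)..T, ∫ t in (0 : ℝ)..T,
        (exp (-(a * |t - s|)) - exp (-(a * (t + s)))) ^ 2
      = ∫ s in (0 : ℝ)..T, ((1 - exp (-2 * a * s + 0)) / a - 2 * s * exp (-2 * a * s + 0)
        - exp (-2 * a * T) * (exp (2 * a * s + 0) - 2 + exp (-2 * a * s + 0)) / (2 * a)) := by
    refine integral_congr fun s hs => ?_
    rw [Set.uIcc_of_le hT] at hs
    simpa only [add_zero] using integral_sq_ou_kernel ha hs.1 hs.2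
  rw [hcongr, integral_eq_sub_of_hasDerivAt
    (f := fun s => s / a + exp (-2 * a * s + 0) / a ^ 2 + s * exp (-2 * a * s + 0) / a
      - exp (-2 * a * T) * (exp (2 * a * s + 0) / (2 * a) - 2 * s
        - exp (-2 * a * s + 0) / (2 * a)) / (2 * a))]
  · have h : exp (2 * a * T) = (exp (-2 * a * T))⁻¹ := by rw [← exp_neg]; ring_nf
    have hne := exp_ne_zero (-2 * a * T)
    simp only [h, add_zero, mul_zero, exp_zero]
    generalize exp (-2 * a * T) = x at hne
    field_simp
    ring
  · intro s _
    have hm := hasDerivAt_exp_affine (-2 * a) 0 s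
    have hp := hasDerivAt_exp_affine (2 * a) 0 s
    have hi := hasDerivAt_id s
    refine ((((hi.div_const a).add (hm.div_const (a ^ 2))).add ((hi.mul hm).div_const a)).sub
      (((((hp.div_const (2 * a)).sub (hi.const_mul 2)).sub
        (hm.div_const (2 * a))).const_mul (exp (-2 * a * T))).div_const (2 * a))).congr_deriv ?_
    simp only [id]
    field_simp
    ring
  · exact (by fun_prop : Continuous _).intervalIntegrable _ _

/-- Explicit formula for `2∫_0^T∫_0^T C(s,t)² ds dt`, where `C` is the covariance
function of the Ornstein–Uhlenbeck process: this is the variance of `∫_0^T u(t)² dt`. -/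
theorem stmt3 (θ σ ν q T : ℝ) (hθ : 0 < θ) (hσ : 0 < σ) (hν : 0 < ν) (hq : 0 < q)
    (hT : 0 < T) :
    2 * ∫ s in (0 : ℝ)..T, ∫ t in (0 : ℝ)..T,
        ((σ ^ 2 * q ^ 2 / (2 * θ * ν)) *
          (Real.exp (-(θ * ν * |t - s|)) - Real.exp (-(θ * ν * (t + s))))) ^ 2
      = (σ ^ 4 * q ^ 4 / (4 * θ ^ 2 * ν ^ 2)) *
          (2 * T / (θ * ν) + 2 * Real.exp (-(2 * θ * ν * T)) / (θ ^ 2 * ν ^ 2)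
            + Real.exp (-(4 * θ * ν * T)) / (2 * θ ^ 2 * ν ^ 2)
            + 4 * T * Real.exp (-(2 * θ * ν * T)) / (θ * ν)
            - 5 / (2 * θ ^ 2 * ν ^ 2)) := by
  simp only [mul_pow _ (_ - _), intervalIntegral.integral_const_mul]
  rw [integral_integral_sq_ou_kernel (mul_pos hθ hν).ne' hT.le]
  have h2 : exp (-(2 * θ * ν * T)) = exp (-2 * (θ * ν) * T) := by ring_nf
  have h4 : exp (-(4 * θ * ν * T)) = exp (-2 * (θ * ν) * T) ^ 2 := by
    rw [← exp_nat_mul]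
    ring_nf
  rw [h2, h4]
  field_simp
  ring
end
end

section
/- Let θ, σ, T > 0, α, ρ ∈ ℝ, and let (ν_k)_{k≥1}, (q_k)_{k≥1} be positive sequences with ν_k → ∞ and q_k → 0. Assume there exists M ∈ ℝ with ν_n^{α−1} q_n^{2ρ+2} ≤ M for all n, and Σ_{k≥1} ν_k^{α} q_k^{2ρ+2} = ∞. Define e_k := (σ²/(2θ)) ν_k^{α} q_k^{2ρ+2} ( T − (1 − e^{−2θν_kT})/(2θν_k) ), b_n := Σ_{k=1}^n e_k, and V_k := (σ⁴/(4θ²)) ν_k^{2α−2} q_k^{4ρ+4} ( 2T/(θν_k) + 2e^{−2θν_kT}/(θ²ν_k²) + e^{−4θν_kT}/(2θ²ν_k²) + 4T e^{−2θν_kT}/(θν_k) − 5/(2θ²ν_k²) ) · ν_k². Then b_n → ∞ and Σ_{n≥1} V_n / b_n² < ∞. -/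
open MeasureTheory Real Filter

noncomputable section

theorem summable_sub_div_sq_of_monotone {b : ℕ → ℝ} (hb : Monotone b) (h0 : 0 < b 0) :
    Summable (fun n : ℕ => (b (n + 1) - b n) / b (n + 1) ^ 2) := by
  have hpos : ∀ n, 0 < b n := fun n => h0.trans_le (hb (Nat.zero_le n))
  have hpartial : ∀ n, ∑ i ∈ Finset.range n, (b (i + 1) - b i) / b (i + 1) ^ 2
      ≤ 1 / b 0 - 1 / b n := by
    intro n
    induction n with
    | zero => simp
    | succ n ih =>
      rw [Finset.sum_range_succ]
      have hn := hpos n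
      have hn' := hpos (n + 1)
      have hle := hb (Nat.le_succ n)
      have hstep : (b (n + 1) - b n) / b (n + 1) ^ 2 ≤ 1 / b n - 1 / b (n + 1) := by
        calc (b (n + 1) - b n) / b (n + 1) ^ 2
            ≤ (b (n + 1) - b n) / (b n * b (n + 1)) := by
              apply div_le_div_of_nonneg_left (sub_nonneg.2 hle) (by positivity)
              rw [sq]
              exact mul_le_mul_of_nonneg_right hle hn'.le
          _ = 1 / b n - 1 / b (n + 1) := by field_simp
      linarith
  refine summable_of_sum_range_le (c := 1 / b 0)
    (fun n => div_nonneg (sub_nonneg.2 (hb (Nat.le_succ n))) (sq_nonneg _)) fun n => ?_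
  have : 0 < 1 / b n := one_div_pos.2 (hpos n)
  linarith [hpartial n]

/-- The mean of the time-integrated square of an Ornstein–Uhlenbeck process is positive. -/
theorem sub_one_sub_exp_neg_div_pos {c T : ℝ} (hc : 0 < c) (hT : 0 < T) :
    0 < T - (1 - Real.exp (-(c * T))) / c := by
  have hne : -(c * T) ≠ 0 := (neg_lt_zero.2 (by positivity)).ne
  rw [sub_pos, div_lt_iff₀ hc]
  linarith [Real.add_one_lt_exp hne]

theorem half_le_sub_one_sub_exp_neg_div {c T : ℝ} (hc : 0 < c) (hcT : 2 ≤ c * T) :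
    T / 2 ≤ T - (1 - Real.exp (-(c * T))) / c := by
  have h : (1 - Real.exp (-(c * T))) / c ≤ T / 2 := by
    rw [div_le_iff₀ hc]
    linarith [Real.exp_pos (-(c * T))]
  linarith

theorem abs_variance_bracket_le {θ T x E F : ℝ} (hθ : 0 < θ) (hx : 0 < x)
    (hxT : 1 ≤ θ * x * T) (hE0 : 0 ≤ E) (hE1 : E ≤ 1) (hF0 : 0 ≤ F) (hF1 : F ≤ 1) :
    |2 * T / (θ * x) + 2 * E / (θ ^ 2 * x ^ 2) + F / (2 * θ ^ 2 * x ^ 2)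
      + 4 * T * E / (θ * x) - 5 / (2 * θ ^ 2 * x ^ 2)| ≤ 11 * T / (θ * x) := by
  have hθx : 0 < θ * x := by positivity
  have hT : 0 < T := by
    by_contra! h
    nlinarith
  have hrw : 2 * T / (θ * x) + 2 * E / (θ ^ 2 * x ^ 2) + F / (2 * θ ^ 2 * x ^ 2)
      + 4 * T * E / (θ * x) - 5 / (2 * θ ^ 2 * x ^ 2)
      = (2 * T + 4 * T * E + (2 * E + F / 2 - 5 / 2) / (θ * x)) / (θ * x) := by
    field_simp
    ring
  have hy : 1 / (θ * x) ≤ T := by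
    rw [div_le_iff₀ hθx]
    linarith
  have hy0 : 0 < 1 / (θ * x) := by positivity
  rw [hrw, abs_div, abs_of_pos hθx, div_eq_mul_one_div (2 * E + F / 2 - 5 / 2)]
  gcongr
  have hTE0 := mul_nonneg hT.le hE0
  have hTE1 := mul_le_mul_of_nonneg_left hE1 hT.le
  rw [abs_le]
  constructor <;> nlinarith

/-- The key deterministic estimate in the consistency proof of the spectral MLE:
`b_n = Σ_{k≤n} E[η_k] → ∞` and `Σ_n Var(η_n)/b_n² < ∞`. -/
theorem stmt4 (θ σ T α ρ : ℝ) (hθ : 0 < θ) (hσ : 0 < σ) (hT : 0 < T)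
    (ν q : ℕ → ℝ) (hν : ∀ k, 0 < ν k) (hq : ∀ k, 0 < q k)
    (hνlim : Tendsto ν atTop atTop) (hqlim : Tendsto q atTop (nhds 0))
    (M : ℝ) (hM : ∀ n, 1 ≤ n → ν n ^ (α - 1) * q n ^ (2 * ρ + 2) ≤ M)
    (hdiv : Tendsto (fun N : ℕ => ∑ k ∈ Finset.Icc 1 N, ν k ^ α * q k ^ (2 * ρ + 2))
      atTop atTop)
    (e b V : ℕ → ℝ)
    (he : ∀ k, e k = (σ ^ 2 / (2 * θ)) * ν k ^ α * q k ^ (2 * ρ + 2) *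
      (T - (1 - Real.exp (-(2 * θ * ν k * T))) / (2 * θ * ν k)))
    (hb : ∀ n, b n = ∑ k ∈ Finset.Icc 1 n, e k)
    (hV : ∀ k, V k = (σ ^ 4 / (4 * θ ^ 2)) * ν k ^ (2 * α - 2) * q k ^ (4 * ρ + 4) *
      (2 * T / (θ * ν k) + 2 * Real.exp (-(2 * θ * ν k * T)) / (θ ^ 2 * ν k ^ 2)
        + Real.exp (-(4 * θ * ν k * T)) / (2 * θ ^ 2 * ν k ^ 2)
        + 4 * T * Real.exp (-(2 * θ * ν k * T)) / (θ * ν k)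
        - 5 / (2 * θ ^ 2 * ν k ^ 2)) * ν k ^ 2) :
    Tendsto b atTop atTop ∧ Summable (fun n : ℕ => V (n + 1) / b (n + 1) ^ 2) := by
  set a : ℕ → ℝ := fun k => ν k ^ α * q k ^ (2 * ρ + 2) with ha
  have ha0 : ∀ k, 0 < a k := fun k =>
    mul_pos (rpow_pos_of_pos (hν k) _) (rpow_pos_of_pos (hq k) _)
  set C : ℝ := σ ^ 2 / (2 * θ) with hC
  have hC0 : 0 < C := by positivity
  have he' : ∀ k, e k = C * a k *
      (T - (1 - Real.exp (-(2 * θ * ν k * T))) / (2 * θ * ν k)) := by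
    intro k
    rw [he k, ha]
    ring
  have hepos : ∀ k, 0 < e k := by
    intro k
    rw [he' k]
    have hνk := hν k
    exact mul_pos (mul_pos hC0 (ha0 k)) (sub_one_sub_exp_neg_div_pos (by positivity) hT)
  have hbsucc : ∀ n, b (n + 1) = b n + e (n + 1) := by
    intro n
    rw [hb, hb, Finset.sum_Icc_succ_top (by omega)]
  have hbmono : Monotone b := monotone_nat_of_le_succ fun n => by
    linarith [hbsucc n, hepos (n + 1)]
  have hb0 : b 0 = 0 := by simp [hb]
  obtain ⟨K, hK⟩ : ∃ K, ∀ k, K ≤ k → 1 ≤ θ * ν k * T := by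
    obtain ⟨K, hK⟩ := eventually_atTop.1 (hνlim.eventually_ge_atTop (1 / (θ * T)))
    refine ⟨K, fun k hk => ?_⟩
    have h := hK k hk
    rw [div_le_iff₀ (by positivity)] at h
    linarith
  have hea : ∀ k, K ≤ k → C * T / 2 * a k ≤ e k := by
    intro k hk
    have hνk := hν k
    rw [he' k]
    calc C * T / 2 * a k = C * a k * (T / 2) := by ring
      _ ≤ _ := mul_le_mul_of_nonneg_left
        (half_le_sub_one_sub_exp_neg_div (by positivity) (by linarith [hK k hk]))
        (mul_pos hC0 (ha0 k)).le
  refine ⟨?_, ?_⟩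
  · set A : ℕ → ℝ := fun N => ∑ k ∈ Finset.Icc 1 N, a k with hA
    have hlow : ∀ n, K ≤ n → C * T / 2 * A n + -(C * T / 2 * A K) ≤ b n := by
      intro n hn
      induction n, hn using Nat.le_induction with
      | base => linarith [hbmono (Nat.zero_le K)]
      | succ n hn ih =>
        have hAsucc : A (n + 1) = A n + a (n + 1) := by
          simp only [hA]
          rw [Finset.sum_Icc_succ_top (by omega)]
        rw [hAsucc, hbsucc]
        linarith [hea (n + 1) (by omega)]
    exact tendsto_atTop_mono' atTop (eventually_atTop.2 ⟨K, hlow⟩)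
      (tendsto_atTop_add_const_right _ _ (hdiv.const_mul_atTop (by positivity)))
  · have hVe : ∀ k, 1 ≤ k → K ≤ k → |V k| ≤ 22 * C * M / θ * e k := by
      intro k hk1 hk
      have hνk := hν k
      have hqk := hq k
      set m : ℝ := ν k ^ (α - 1) * q k ^ (2 * ρ + 2) with hm
      have hm0 : 0 < m := mul_pos (rpow_pos_of_pos hνk _) (rpow_pos_of_pos hqk _)
      have ham : a k = m * ν k := by
        have : ν k ^ α = ν k ^ (α - 1) * ν k := by
          rw [rpow_sub_one hνk.ne']
          field_simp
        simp only [ha, hm, this]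
        ring
      have hmsq : ν k ^ (2 * α - 2) * q k ^ (4 * ρ + 4) = m ^ 2 := by
        rw [hm, mul_pow, ← rpow_mul_natCast hνk.le, ← rpow_mul_natCast hqk.le]
        congr 2 <;> push_cast <;> ring
      have hVk := hV k
      set B : ℝ := 2 * T / (θ * ν k) + 2 * Real.exp (-(2 * θ * ν k * T)) / (θ ^ 2 * ν k ^ 2)
        + Real.exp (-(4 * θ * ν k * T)) / (2 * θ ^ 2 * ν k ^ 2)
        + 4 * T * Real.exp (-(2 * θ * ν k * T)) / (θ * ν k)
        - 5 / (2 * θ ^ 2 * ν k ^ 2) with hB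
      have hBle : |B| ≤ 11 * T / (θ * ν k) :=
        abs_variance_bracket_le hθ hνk (hK k hk) (Real.exp_pos _).le
          (Real.exp_le_one_iff.2 (neg_nonpos.2 (by positivity))) (Real.exp_pos _).le
          (Real.exp_le_one_iff.2 (neg_nonpos.2 (by positivity)))
      have hVeq : V k = C ^ 2 * a k ^ 2 * B := by
        rw [hVk, mul_assoc (σ ^ 4 / (4 * θ ^ 2)), hmsq, ham, hC]
        ring
      have hM0 : 0 < M := hm0.trans_le (hM k hk1)
      calc |V k| = C ^ 2 * a k ^ 2 * |B| := by
            rw [hVeq, abs_mul, abs_of_nonneg (by positivity)]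
        _ ≤ C ^ 2 * a k ^ 2 * (11 * T / (θ * ν k)) := by gcongr
        _ = 22 * C / θ * m * (C * T / 2 * a k) := by
            rw [ham]
            field_simp
            ring
        _ ≤ 22 * C / θ * M * e k := by
            have := ha0 k
            gcongr
            exacts [hM k hk1, hea k hk]
        _ = 22 * C * M / θ * e k := by ring
    have hb1 : 0 < b 1 := by
      linarith [hbsucc 0, hepos 1]
    have hsum : Summable (fun n : ℕ => e (n + 2) / b (n + 2) ^ 2) := by
      refine (summable_sub_div_sq_of_monotone (b := fun n => b (n + 1))
        (fun i j hij => hbmono (by omega)) hb1).congr fun n => ?_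
      simp only [hbsucc (n + 1), add_sub_cancel_left]
    rw [← summable_nat_add_iff 1]
    refine Summable.of_norm_bounded_eventually_nat (hsum.mul_left (22 * C * M / θ))
      (eventually_atTop.2 ⟨K, fun n hn => ?_⟩)
    rw [Real.norm_eq_abs, abs_div, abs_of_nonneg (sq_nonneg (b (n + 1 + 1))), ← mul_div_assoc]
    exact div_le_div_of_nonneg_right (hVe (n + 2) (by omega) (by omega)) (sq_nonneg _)
end
end
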